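/- Let P be a simple logic program and let M be an answer set of P (a minimal interpretation satisfying all rules of P). Then M is the unique extended answer set of P. -/

import Mathlib

namespace ASP

/-- A literal is an atom `a` or a negated atom `¬ a`. -/
inductive Lit (α : Type) : Type where
  | pos (a : α)
  | neg (a : α)
deriving DecidableEq

/-- Classical negation of a literal. -/
def Lit.negate {α : Type} : Lit α → Lit α
  | .pos a => .neg a
  | .neg a => .pos a

/-- The atom underlying a literal. -/
def Lit.atom {α : Type} : Lit α → α
  | .pos a => a
  | .neg a => a

/-- A rule of a simple logic program: a head which is a literal or absent
(a constraint), and a finite set of literals as body. -/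
structure Rule (α : Type) [DecidableEq α] : Type where
  head : Option (Lit α)
  body : Finset (Lit α)

variable {α : Type} [DecidableEq α]

/-- A set of literals is consistent if it contains no complementary pair. -/
def Consistent (I : Set (Lit α)) : Prop :=
  ∀ a : α, ¬(Lit.pos a ∈ I ∧ Lit.neg a ∈ I)

/-- The Herbrand base of a program: all atoms occurring in it. -/
def herbrand (P : Set (Rule α)) : Set α :=
  {a | ∃ r ∈ P, (∃ l, r.head = some l ∧ l.atom = a) ∨ (∃ l ∈ r.body, l.atom = a)}

/-- An interpretation of `P`: a consistent set of literals over the Herbrand base of `P`. -/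
def IsInterp (P : Set (Rule α)) (I : Set (Lit α)) : Prop :=
  Consistent I ∧ ∀ l ∈ I, l.atom ∈ herbrand P

/-- A rule `a ← β` is satisfied by `I` if `a ∈ I` whenever `β ⊆ I`;
a constraint `← β` is satisfied if its body is not contained in `I`. -/
def Satisfied (I : Set (Lit α)) (r : Rule α) : Prop :=
  ↑r.body ⊆ I → ∃ l, r.head = some l ∧ l ∈ I

/-- A rule is applied w.r.t. `I` if its body holds and its head literal is in `I`. -/
def Applied (I : Set (Lit α)) (r : Rule α) : Prop :=
  ↑r.body ⊆ I ∧ ∃ l, r.head = some l ∧ l ∈ I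

/-- A rule `a ← β` is defeated w.r.t. `P` and `I` iff `P` contains an applied
competing rule `¬a ← β'`. -/
def Defeated (P : Set (Rule α)) (I : Set (Lit α)) (r : Rule α) : Prop :=
  ∃ l, r.head = some l ∧ ∃ r' ∈ P, r'.head = some l.negate ∧ Applied I r'

/-- The reduct of `P` w.r.t. `I`: the rules of `P` satisfied by `I`. -/
def reduct (P : Set (Rule α)) (I : Set (Lit α)) : Set (Rule α) :=
  {r ∈ P | Satisfied I r}

/-- `star R` is the unique minimal model of `R` viewed as a positive program
(negative literals treated as fresh atoms; constraints never fire their head). -/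
def star (R : Set (Rule α)) : Set (Lit α) :=
  ⋂₀ {J : Set (Lit α) | ∀ r ∈ R, ↑r.body ⊆ J → ∀ l, r.head = some l → l ∈ J}

/-- An interpretation is founded iff `(P_I)* = I`. -/
def Founded (P : Set (Rule α)) (I : Set (Lit α)) : Prop :=
  star (reduct P I) = I

/-- A founded interpretation `M` is an extended answer set of `P` iff every rule
of `P` is satisfied or defeated w.r.t. `M`. -/
def ExtAnswerSet (P : Set (Rule α)) (M : Set (Lit α)) : Prop :=
  IsInterp P M ∧ Founded P M ∧ ∀ r ∈ P, Satisfied M r ∨ Defeated P M r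

/-- An answer set of a program without negation as failure: a minimal
interpretation satisfying all rules of the program. -/
def IsAnswerSet (P : Set (Rule α)) (M : Set (Lit α)) : Prop :=
  IsInterp P M ∧ (∀ r ∈ P, Satisfied M r) ∧
    ∀ J, IsInterp P J → (∀ r ∈ P, Satisfied J r) → ¬J ⊂ M


theorem Consistent.negate_notMem {I : Set (Lit α)} (hI : Consistent I) {l : Lit α}
    (hl : l ∈ I) : l.negate ∉ I := by
  cases l with
  | pos a => exact fun h => hI a ⟨hl, h⟩
  | neg a => exact fun h => hI a ⟨h, hl⟩

theorem IsInterp.mono {P : Set (Rule α)} {I J : Set (Lit α)} (hI : IsInterp P I) (h : J ⊆ I) :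
    IsInterp P J :=
  ⟨fun a ha => hI.1 a ⟨h ha.1, h ha.2⟩, fun l hl => hI.2 l (h hl)⟩

theorem star_mono {R S : Set (Rule α)} (h : R ⊆ S) : star R ⊆ star S :=
  Set.sInter_subset_sInter fun _ hJ r hr => hJ r (h hr)

theorem star_closed {R : Set (Rule α)} {r : Rule α} (hr : r ∈ R) (hb : ↑r.body ⊆ star R)
    {l : Lit α} (hl : r.head = some l) : l ∈ star R :=
  Set.mem_sInter.2 fun _ hJ => hJ r hr (hb.trans (Set.sInter_subset_of_mem hJ)) l hl

theorem star_subset_of_satisfied {R : Set (Rule α)} {I : Set (Lit α)}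
    (h : ∀ r ∈ R, Satisfied I r) : star R ⊆ I := by
  refine Set.sInter_subset_of_mem fun r hr hb l hl => ?_
  obtain ⟨l', hl', hI⟩ := h r hr hb
  rw [hl, Option.some.injEq] at hl'
  exact hl' ▸ hI

theorem IsAnswerSet.eq_of_subset {P : Set (Rule α)} {M J : Set (Lit α)} (hM : IsAnswerSet P M)
    (hJM : J ⊆ M) (hJ : ∀ r ∈ P, Satisfied J r) : J = M :=
  by_contra fun hne => hM.2.2 J (hM.1.mono hJM) hJ (hJM.ssubset_of_ne hne)

theorem IsAnswerSet.star_eq {P : Set (Rule α)} {M : Set (Lit α)} (hM : IsAnswerSet P M) :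
    star P = M := by
  have hsub := star_subset_of_satisfied hM.2.1
  refine hM.eq_of_subset hsub fun r hr hb => ?_
  obtain ⟨l, hl, -⟩ := hM.2.1 r hr (hb.trans hsub)
  exact ⟨l, hl, star_closed hr hb hl⟩

/-- If `M` is an answer set of a simple logic program `P` (a
minimal interpretation satisfying all rules of `P`), then `M` is the unique
extended answer set of `P`. -/
theorem answerSet_is_unique_extAnswerSet
    {α : Type} [DecidableEq α] (P : Set (Rule α)) (hP : P.Countable)
    (M : Set (Lit α)) (hM : IsAnswerSet P M) :
    ExtAnswerSet P M ∧ ∀ N, ExtAnswerSet P N → N = M := by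
  refine ⟨⟨hM.1, ?_, fun r hr => Or.inl (hM.2.1 r hr)⟩, fun N ⟨_, hfounded, hN⟩ => ?_⟩
  · have hred : reduct P M = P := Set.sep_eq_self_iff_mem_true.2 hM.2.1
    rw [Founded, hred, hM.star_eq]
  · have hsub : N ⊆ M := by
      rw [← hfounded, ← hM.star_eq]
      exact star_mono (Set.sep_subset _ _)
    refine hM.eq_of_subset hsub fun r hr hb => ?_
    obtain hsat | ⟨l, hl, r', -, hl', -, k, hk, hkN⟩ := hN r hr
    · exact hsat hb
    · obtain ⟨m, hm, hmM⟩ := hM.2.1 r hr (hb.trans hsub)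
      obtain rfl : l = m := Option.some.inj (hl.symm.trans hm)
      obtain rfl : l.negate = k := Option.some.inj (hl'.symm.trans hk)
      exact absurd (hsub hkN) (hM.1.1.negate_notMem hmM)

end ASP
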